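/- arXiv:2303.04832 — 2 statements merged into one kernel-verified Lean document; each statement's English description precedes it below -/
import Mathlib

section
/- There exist ε > 0 and δ0 > 0 such that for every δ ∈ [0, δ0), the global solution φ_δ : ℝ → ℝ of the δ-adjusted angle ODE with initial condition φ_δ(0) = 3π/2 + δ satisfies φ_δ(s) < arctan(9/4) − ε for every s ∈ ℝ with −tanh(s/9) > 0.995. In particular, lim_{s → −∞} φ_δ(s) < arctan(9/4) − ε. -/
namespace Angle

noncomputable def U (s : ℝ) : ℝ := Real.tanh (s / 9)

noncomputable def Z (s : ℝ) : ℝ :=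
  (5 * U s ^ 3 - 3 * U s) / 2 * (s / 9) - 5 / 2 * U s ^ 2 + 2 / 3

noncomputable def W (s : ℝ) : ℝ :=
  1 / 9 * ((15 * U s ^ 2 - 3) / 2 * (1 - U s ^ 2) * (s / 9) + (5 * U s ^ 3 - 3 * U s) / 2
    - 5 * U s * (1 - U s ^ 2)) - 4 / 9 * U s * Z s

/-- `φ` solves the adjusted angle equation. -/
def Sol (δ : ℝ) (φ : ℝ → ℝ) : Prop :=
  ∀ s : ℝ, HasDerivAt φ
            (Real.cos (φ s) ^ 2 + (16 / 81) * Real.sin (φ s) ^ 2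
              - (8 / 9) * (-U s) * Real.sin (φ s) * Real.cos (φ s) - δ) s

lemma hasDerivAt_U (s : ℝ) : HasDerivAt U ((1 - U s ^ 2) / 9) s := by
  have h1 : HasDerivAt (fun s : ℝ => s / 9) (1 / 9) s := (hasDerivAt_id s).div_const 9
  have hc : Real.cosh (s / 9) ≠ 0 := (Real.cosh_pos _).ne'
  have h2 := HasDerivAt.fun_div (h1.sinh) (h1.cosh) hc
  have h3 : U = fun s => Real.sinh (s / 9) / Real.cosh (s / 9) := by
    funext t
    simp [U, Real.tanh_eq_sinh_div_cosh]
  rw [h3]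
  refine h2.congr_deriv ?_
  field_simp

lemma U_lt (s : ℝ) : U s < 1 := Real.tanh_lt_one _
lemma neg_lt_U (s : ℝ) : -1 < U s := Real.neg_one_lt_tanh _

lemma U_strictMono : StrictMono U := by
  apply strictMono_of_deriv_pos
  intro s
  rw [(hasDerivAt_U s).deriv]
  have := U_lt s
  have := neg_lt_U s
  have : 0 < (1 - U s) * (1 + U s) := by apply mul_pos <;> linarith
  nlinarith

lemma U_zero : U 0 = 0 := by simp [U]

lemma U_eq (s : ℝ) : U s * (1 + Real.exp (2 * s / 9)) = Real.exp (2 * s / 9) - 1 := by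
  have h : Real.exp (2 * s / 9) = Real.exp (s / 9) * Real.exp (s / 9) := by
    rw [← Real.exp_add]; ring_nf
  have h2 : Real.exp (s / 9) * Real.exp (-(s / 9)) = 1 := by
    rw [← Real.exp_add]; simp
  rw [U, Real.tanh_eq, h]
  have h3 := Real.exp_pos (s / 9)
  have h4 := Real.exp_pos (-(s / 9))
  rw [div_mul_eq_mul_div, div_eq_iff (by positivity)]
  linear_combination (-2 * Real.exp (s/9) ) * h2

lemma U_tendsto : Filter.Tendsto U Filter.atBot (nhds (-1)) := by
  have h0 : Filter.Tendsto (fun s : ℝ => Real.exp (2 * s / 9)) Filter.atBot (nhds 0) := by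
    apply Real.tendsto_exp_atBot.comp
    have : (fun s : ℝ => 2 * s / 9) = fun s => (2 / 9) * s := by funext s; ring
    rw [this]
    exact Filter.tendsto_id.const_mul_atBot (by norm_num)
  have h1 : U = fun s => (Real.exp (2 * s / 9) - 1) / (1 + Real.exp (2 * s / 9)) := by
    funext s
    rw [eq_div_iff (by positivity), U_eq]
  rw [h1]
  have := (h0.sub_const 1).div (h0.const_add 1) (by norm_num)
  norm_num at this
  exact this

lemma U_a : -0.8 < U (-9) ∧ U (-9) < -0.7 := by
  have h := U_eq (-9)
  have he : Real.exp (2 * (-9) / 9) * (Real.exp 1 * Real.exp 1) = 1 := by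
    rw [← Real.exp_add, ← Real.exp_add]; norm_num
  have h1 := Real.exp_one_gt_d9
  have h2 := Real.exp_one_lt_d9
  set E := Real.exp (2 * (-9) / 9)
  have hE : 0 < E := Real.exp_pos _
  have h3 : 7.38 < Real.exp 1 * Real.exp 1 := by nlinarith
  have h4 : Real.exp 1 * Real.exp 1 < 7.4 := by nlinarith
  have h5 : E < 0.136 := by by_contra hc; push Not at hc; nlinarith
  have h6 : 0.135 < E := by by_contra hc; push Not at hc; nlinarith
  constructor <;> nlinarith

lemma U_b : -0.995 < U (-22.5) ∧ U (-22.5) < -0.98 := by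
  have h := U_eq (-22.5)
  have he : Real.exp (2 * (-22.5) / 9) * (Real.exp 1) ^ 5 = 1 := by
    rw [← Real.exp_nat_mul, ← Real.exp_add]; norm_num
  have h1 := Real.exp_one_gt_d9
  have h2 := Real.exp_one_lt_d9
  set E := Real.exp (2 * (-22.5) / 9)
  have hE : 0 < E := Real.exp_pos _
  have h3 : (2.7:ℝ) ^ 5 < Real.exp 1 ^ 5 := by gcongr; linarith
  have h4 : Real.exp 1 ^ 5 < 2.72 ^ 5 := by gcongr; linarith
  generalize Real.exp 1 ^ 5 = a at he h3 h4
  norm_num at h3 h4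
  have h5 : E < 0.008 := by by_contra hc; push Not at hc; nlinarith
  have h6 : 0.006 < E := by by_contra hc; push Not at hc; nlinarith
  constructor <;> nlinarith

lemma hasDerivAt_Z (s : ℝ) : HasDerivAt Z (W s + 4 / 9 * U s * Z s) s := by
  have hu := hasDerivAt_U s
  have h1 : HasDerivAt (fun s : ℝ => s / 9) (1 / 9) s := (hasDerivAt_id s).div_const 9
  have h := ((((((hu.pow 3).const_mul 5).sub (hu.const_mul 3)).div_const 2).mul h1).sub
    ((hu.pow 2).const_mul (5/2))).add_const (2/3)
  refine HasDerivAt.congr_deriv h ?_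
  simp only [W, Pi.pow_apply, Pi.sub_apply]
  push_cast
  ring

lemma hasDerivAt_W (s : ℝ) : HasDerivAt W (-(4 / 9) * U s * W s - 16 / 81 * Z s) s := by
  have hu := hasDerivAt_U s
  have hz := hasDerivAt_Z s
  have h1 : HasDerivAt (fun s : ℝ => s / 9) (1 / 9) s := (hasDerivAt_id s).div_const 9
  have h := (((((((((hu.pow 2).const_mul 15).sub_const 3).div_const 2).mul
    ((hu.pow 2).const_sub 1)).mul h1).add
    ((((hu.pow 3).const_mul 5).sub (hu.const_mul 3)).div_const 2)).sub
    ((hu.const_mul 5).mul ((hu.pow 2).const_sub 1))).const_mul (1/9)).sub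
    ((hu.const_mul (4/9)).mul hz)
  refine HasDerivAt.congr_deriv h ?_
  simp only [W, Z, Pi.pow_apply, Pi.sub_apply, Pi.mul_apply]
  push_cast
  ring

lemma Z_zero : Z 0 = 2 / 3 := by simp [Z, U_zero]
lemma W_zero : W 0 = 0 := by simp [W, U_zero]

lemma Z_a : Z (-9) < 0 := by
  obtain ⟨h1, h2⟩ := U_a
  unfold Z
  set u := U (-9)
  norm_num at *
  nlinarith [mul_pos (sub_pos.2 h1) (sub_pos.2 h2), mul_pos (mul_pos (sub_pos.2 h1) (sub_pos.2 h2)) (sub_pos.2 h2)]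

lemma Z_pos {s : ℝ} (hs : s ≤ -22.5) : 0 < Z s := by
  have h1 : U s < -0.98 := (U_strictMono.monotone hs).trans_lt U_b.2
  have h2 := neg_lt_U s
  unfold Z
  set u := U s
  have hp : 0 < (3 * u - 5 * u ^ 3) / 2 := by
    have : 0.96 < u ^ 2 := by nlinarith
    nlinarith [mul_pos (neg_pos.2 (h1.trans (by norm_num : (-0.98:ℝ) < 0))) (sub_pos.2 this)]
  have : (3 * u - 5 * u ^ 3) / 2 * (s / 9) ≤ (3 * u - 5 * u ^ 3) / 2 * (-2.5) := by
    apply mul_le_mul_of_nonneg_left _ hp.le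
    norm_num at *; linarith
  norm_num at *
  nlinarith [mul_pos (sub_pos.2 h1) (sub_pos.2 h2), mul_pos (mul_pos (sub_pos.2 h1) (sub_pos.2 h2)) (sub_pos.2 h1)]

lemma W_ne {s : ℝ} (hz : Z s = 0) : W s ≠ 0 := by
  intro hw
  have h : ((15 * U s ^ 2 - 3) / 2 * (1 - U s ^ 2)) * Z s
      - (5 * U s ^ 3 - 3 * U s) / 2 * (9 * (W s + 4 / 9 * U s * Z s)) = -1 := by
    simp only [W, Z]; ring
  rw [hz, hw] at h
  norm_num at h

end Angle
namespace Angle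

noncomputable def G (φ : ℝ → ℝ) (s : ℝ) : ℝ := W s * Real.sin (φ s) - Z s * Real.cos (φ s)

lemma hasDerivAt_G {δ : ℝ} {φ : ℝ → ℝ} (h : Sol δ φ) (s : ℝ) :
    HasDerivAt (G φ) ((4 / 9 * U s * (Real.cos (φ s) ^ 2 - Real.sin (φ s) ^ 2)
      - 65 / 81 * Real.sin (φ s) * Real.cos (φ s)) * G φ s
      - δ * (W s * Real.cos (φ s) + Z s * Real.sin (φ s))) s := by
  have h1 := ((hasDerivAt_W s).mul (h s).sin).sub ((hasDerivAt_Z s).mul (h s).cos)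
  refine HasDerivAt.congr_deriv h1 ?_
  unfold G
  have hsc := Real.sin_sq_add_cos_sq (φ s)
  generalize Real.sin (φ s) = a at *
  generalize Real.cos (φ s) = b at *
  have hb : b ^ 2 = 1 - a ^ 2 := by linarith
  have hb3 : b ^ 3 = b * (1 - a ^ 2) := by rw [← hb]; ring
  ring_nf
  rw [hb3, hb]
  ring

lemma neg_comp {f : ℝ → ℝ} {f' t : ℝ} (h : HasDerivAt f f' (-t)) :
    HasDerivAt (fun t => f (-t)) (-f') t := by
  have := h.comp t (hasDerivAt_neg t)
  refine HasDerivAt.congr_deriv this ?_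
  ring

lemma G_bound {δ : ℝ} {φ : ℝ → ℝ} (hδ : 0 ≤ δ) (h : Sol δ φ)
    (h0 : φ 0 = 3 * Real.pi / 2 + δ) {M T : ℝ} (hT : 0 ≤ T)
    (hM : ∀ s ∈ Set.Icc (-T) 0, |W s| + |Z s| ≤ M) :
    ∀ s ∈ Set.Icc (-T) 0, |G φ s| ≤ δ * (Real.exp (2 * T) + M / 2 * Real.exp (2 * T)) := by
  intro s hs
  have hM0 : 0 ≤ M := le_trans (by positivity) (hM s hs)
  have key := norm_le_gronwallBound_of_norm_deriv_right_le (f := fun t => G φ (-t))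
    (f' := fun t => -((4 / 9 * U (-t) * (Real.cos (φ (-t)) ^ 2 - Real.sin (φ (-t)) ^ 2)
      - 65 / 81 * Real.sin (φ (-t)) * Real.cos (φ (-t))) * G φ (-t)
      - δ * (W (-t) * Real.cos (φ (-t)) + Z (-t) * Real.sin (φ (-t)))))
    (δ := δ) (K := 2) (ε := δ * M) (a := 0) (b := T)
    (fun t _ => (neg_comp (hasDerivAt_G h (-t))).continuousAt.continuousWithinAt)
    (fun t _ => (neg_comp (hasDerivAt_G h (-t))).hasDerivWithinAt) ?_ ?_ (-s)
    ⟨by linarith [hs.2], by linarith [hs.1]⟩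
  · simp only [neg_neg, sub_zero, Real.norm_eq_abs] at key
    refine key.trans ?_
    rw [gronwallBound_of_K_ne_0 (by norm_num)]
    have he : Real.exp (2 * -s) ≤ Real.exp (2 * T) := Real.exp_le_exp.2 (by linarith [hs.1])
    have e1 : δ * Real.exp (2 * -s) ≤ δ * Real.exp (2 * T) := by gcongr
    have e2 : δ * M * Real.exp (2 * -s) ≤ δ * M * Real.exp (2 * T) := by gcongr
    have e3 : 0 ≤ δ * M := by positivity
    simp only
    linarith
  · simp only [neg_zero, G, W_zero, Z_zero, h0, Real.norm_eq_abs]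
    have : Real.cos (3 * Real.pi / 2 + δ) = Real.sin δ := by
      have : 3 * Real.pi / 2 + δ = (δ - Real.pi / 2) + 2 * Real.pi := by ring
      rw [this, Real.cos_add_two_pi, Real.cos_sub_pi_div_two]
    rw [this, zero_mul, zero_sub, abs_neg, abs_mul]
    have h1 : |Real.sin δ| ≤ |δ| := Real.abs_sin_le_abs
    rw [abs_of_nonneg hδ] at h1
    have h2 : |(2:ℝ)/3| = 2 / 3 := abs_of_pos (by norm_num)
    rw [h2]
    linarith [abs_nonneg (Real.sin δ)]
  · intro t ht
    simp only [Real.norm_eq_abs, abs_neg]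
    have hm := hM (-t) ⟨by linarith [ht.2], by linarith [ht.1]⟩
    have hu1 := U_lt (-t)
    have hu2 := neg_lt_U (-t)
    have hc := Real.abs_cos_le_one (φ (-t))
    have hs := Real.abs_sin_le_one (φ (-t))
    have hsc := Real.sin_sq_add_cos_sq (φ (-t))
    generalize Real.sin (φ (-t)) = a at *
    generalize Real.cos (φ (-t)) = b at *
    refine (abs_sub _ _).trans ?_
    rw [abs_mul, abs_mul]
    have i1 : |4 / 9 * U (-t) * (b ^ 2 - a ^ 2) - 65 / 81 * a * b| ≤ 2 := by
      have hab : |a * b| ≤ 1 := by rw [abs_mul]; exact mul_le_one₀ hs (abs_nonneg _) hc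
      have hub : |U (-t) * (b ^ 2 - a ^ 2)| ≤ 1 := by
        rw [abs_mul]
        refine mul_le_one₀ (abs_le.2 ⟨hu2.le, hu1.le⟩) (abs_nonneg _) (abs_le.2 ⟨?_, ?_⟩) <;> nlinarith
      rw [abs_le] at *
      constructor <;> nlinarith
    have i2 : |W (-t) * b + Z (-t) * a| ≤ M := by
      refine (abs_add_le _ _).trans (le_trans ?_ hm)
      rw [abs_mul, abs_mul]
      have := mul_le_mul_of_nonneg_left hc (abs_nonneg (W (-t)))
      have := mul_le_mul_of_nonneg_left hs (abs_nonneg (Z (-t)))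
      linarith
    rw [abs_of_nonneg hδ]
    gcongr

lemma barrier {f f' : ℝ → ℝ} {S p : ℝ} (hf : ∀ s, HasDerivAt f (f' s) s)
    (hS : f S ≤ p) (hb : ∀ s ≤ S, f s = p → 0 < f' s) : ∀ s ≤ S, f s ≤ p := by
  intro s hs
  have := image_le_of_deriv_right_lt_deriv_boundary (f := fun t => f (-t))
    (f' := fun t => -f' (-t)) (a := -S) (b := -s) (B := fun _ => p) (B' := fun _ => 0)
    (fun t _ => (neg_comp (hf (-t))).continuousAt.continuousWithinAt)
    (fun t _ => (neg_comp (hf (-t))).hasDerivWithinAt) (by simpa using hS)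
    (fun t => hasDerivAt_const t p)
    (fun t ht h => by
      have := hb (-t) (by linarith [ht.1]) h
      simpa using this)
    (x := -s) ⟨by linarith, le_rfl⟩
  simpa using this

lemma barrier' {f f' : ℝ → ℝ} {S p : ℝ} (hf : ∀ s, HasDerivAt f (f' s) s)
    (hS : p ≤ f S) (hb : ∀ s ≤ S, f s = p → f' s < 0) : ∀ s ≤ S, p ≤ f s := by
  intro s hs
  have := barrier (f := fun s => -f s) (f' := fun s => -f' s) (S := S) (p := -p)
    (fun s => (hf s).neg) (by simpa using hS)
    (fun s hs h => by simpa using hb s hs (by linarith)) s hs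
  linarith

/-- Limit vector field. -/
noncomputable def F (δ p : ℝ) : ℝ := (Real.cos p - 4 / 9 * Real.sin p) ^ 2 - δ

lemma exists_F_ne (δ : ℝ) {a b : ℝ} (hab : a < b) : ∃ p ∈ Set.Ioo a b, F δ p ≠ 0 := by
  by_contra hc
  push Not at hc
  have d1 : ∀ p, HasDerivAt (F δ) (2 * (Real.cos p - 4 / 9 * Real.sin p) *
      (-Real.sin p - 4 / 9 * Real.cos p)) p := by
    intro p
    have := (((Real.hasDerivAt_cos p).sub ((Real.hasDerivAt_sin p).const_mul (4/9))).pow 2).sub_const δ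
    refine HasDerivAt.congr_deriv this ?_
    simp
  have z1 : ∀ p ∈ Set.Ioo a b, 2 * (Real.cos p - 4 / 9 * Real.sin p) *
      (-Real.sin p - 4 / 9 * Real.cos p) = 0 := by
    intro p hp
    have hev : F δ =ᶠ[nhds p] fun _ => 0 := by
      filter_upwards [Ioo_mem_nhds hp.1 hp.2] with q hq using hc q hq
    exact (d1 p).unique ((hasDerivAt_const p (0:ℝ)).congr_of_eventuallyEq hev)
  have d2 : ∀ p, HasDerivAt (fun p => 2 * (Real.cos p - 4 / 9 * Real.sin p) *
      (-Real.sin p - 4 / 9 * Real.cos p)) (2 * (-Real.sin p - 4 / 9 * Real.cos p) *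
      (-Real.sin p - 4 / 9 * Real.cos p) + 2 * (Real.cos p - 4 / 9 * Real.sin p) *
      (-Real.cos p + 4 / 9 * Real.sin p)) p := by
    intro p
    have := (((Real.hasDerivAt_cos p).sub ((Real.hasDerivAt_sin p).const_mul (4/9))).const_mul 2).mul
      ((Real.hasDerivAt_sin p).neg.sub ((Real.hasDerivAt_cos p).const_mul (4/9)))
    refine HasDerivAt.congr_deriv this ?_
    simp
  obtain ⟨p, hp⟩ : (Set.Ioo a b).Nonempty := Set.nonempty_Ioo.2 hab
  have z2 : 2 * (-Real.sin p - 4 / 9 * Real.cos p) *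
      (-Real.sin p - 4 / 9 * Real.cos p) + 2 * (Real.cos p - 4 / 9 * Real.sin p) *
      (-Real.cos p + 4 / 9 * Real.sin p) = 0 := by
    have hev : (fun p => 2 * (Real.cos p - 4 / 9 * Real.sin p) *
      (-Real.sin p - 4 / 9 * Real.cos p)) =ᶠ[nhds p] fun _ => 0 := by
      filter_upwards [Ioo_mem_nhds hp.1 hp.2] with q hq using z1 q hq
    exact (d2 p).unique ((hasDerivAt_const p (0:ℝ)).congr_of_eventuallyEq hev)
  have z1 := z1 p hp
  have hsc := Real.sin_sq_add_cos_sq p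
  generalize Real.sin p = x at *
  generalize Real.cos p = y at *
  rcases mul_eq_zero.1 z1 with h | h
  · have : y = 4 / 9 * x := by linarith
    subst this
    nlinarith
  · have : x = - (4 / 9) * y := by linarith
    subst this
    nlinarith

/-- Eventually the sign of `φ'` at `φ = p` is the sign of `F`. -/
lemma eventually_close (c : ℝ) (hc : 0 < c) : ∃ S : ℝ, ∀ s ≤ S, ∀ δ x : ℝ,
    |(Real.cos x ^ 2 + (16 / 81) * Real.sin x ^ 2
      - (8 / 9) * (-U s) * Real.sin x * Real.cos x - δ) - F δ x| < c := by
  have h := (Metric.tendsto_nhds.1 U_tendsto) c hc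
  obtain ⟨S, hS⟩ := Filter.eventually_atBot.1 h
  refine ⟨S, fun s hs δ x => ?_⟩
  have h1 := hS s hs
  rw [Real.dist_eq] at h1
  have : (Real.cos x ^ 2 + (16 / 81) * Real.sin x ^ 2
      - (8 / 9) * (-U s) * Real.sin x * Real.cos x - δ) - F δ x
      = (U s - -1) * (8 / 9 * Real.sin x * Real.cos x) := by unfold F; ring
  rw [this, abs_mul]
  have h2 : |8 / 9 * Real.sin x * Real.cos x| ≤ 1 := by
    rw [mul_assoc, abs_mul, abs_mul]
    have h3 : |Real.sin x| * |Real.cos x| ≤ 1 :=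
      mul_le_one₀ (Real.abs_sin_le_one x) (abs_nonneg _) (Real.abs_cos_le_one x)
    rw [abs_of_pos (by norm_num : (0:ℝ) < 8 / 9)]
    linarith
  have := mul_le_mul_of_nonneg_left h2 (abs_nonneg (U s - -1))
  linarith

lemma exists_limit {δ : ℝ} {φ : ℝ → ℝ} (h : Sol δ φ) {S A B : ℝ}
    (hA : ∀ s ≤ S, A ≤ φ s) (hB : ∀ s ≤ S, φ s ≤ B) :
    ∃ L, Filter.Tendsto φ Filter.atBot (nhds L) := by
  refine tendsto_of_no_upcrossings (s := Set.univ) dense_univ ?_ ?_ ?_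
  · rintro a - b - hab ⟨f1, f2⟩
    obtain ⟨p, hp, hF⟩ := exists_F_ne δ hab
    obtain ⟨S', hS'⟩ := eventually_close |F δ p| (abs_pos.2 hF)
    rcases lt_or_gt_of_ne hF with hn | hn
    · obtain ⟨s0, hs0, hs1⟩ := (f2.and_eventually (Filter.eventually_le_atBot S')).exists
      have := barrier' h (S := s0) (p := p) (by linarith [hp.2]) (fun s hs hsp => by
        have := hS' s (by linarith) δ (φ s)
        rw [hsp] at *
        rw [abs_of_neg hn, abs_lt] at this
        linarith [this.2])
      obtain ⟨s2, h2, h3⟩ := (f1.and_eventually (Filter.eventually_le_atBot s0)).exists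
      linarith [this s2 h3, hp.1]
    · obtain ⟨s0, hs0, hs1⟩ := (f1.and_eventually (Filter.eventually_le_atBot S')).exists
      have := barrier h (S := s0) (p := p) (by linarith [hp.1]) (fun s hs hsp => by
        have := hS' s (by linarith) δ (φ s)
        rw [hsp] at *
        rw [abs_of_pos hn, abs_lt] at this
        linarith [this.1])
      obtain ⟨s2, h2, h3⟩ := (f2.and_eventually (Filter.eventually_le_atBot s0)).exists
      linarith [this s2 h3, hp.2]
  · exact ⟨B, Filter.eventually_map.2 (Filter.eventually_atBot.2 ⟨S, hB⟩)⟩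
  · exact ⟨A, Filter.eventually_map.2 (Filter.eventually_atBot.2 ⟨S, hA⟩)⟩

lemma exists_lower_pos {δ : ℝ} {φ : ℝ → ℝ} (hδ : 0 < δ) (h : Sol δ φ) :
    ∃ S A : ℝ, ∀ s ≤ S, A ≤ φ s := by
  obtain ⟨S, hS⟩ := eventually_close δ hδ
  obtain ⟨n, hn⟩ := exists_nat_ge ((Real.arctan (9 / 4) - φ S) / Real.pi)
  rw [div_le_iff₀ Real.pi_pos] at hn
  set p := Real.arctan (9 / 4) - n * Real.pi with hp
  have hFp : F δ p = -δ := by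
    have h1 : Real.cos (Real.arctan (9/4)) - 4 / 9 * Real.sin (Real.arctan (9/4)) = 0 := by
      rw [Real.cos_arctan, Real.sin_arctan]; ring
    have : Real.cos p - 4 / 9 * Real.sin p = 0 := by
      rw [hp, Real.cos_sub_nat_mul_pi, Real.sin_sub_nat_mul_pi]
      linear_combination (-1) ^ n * h1
    rw [F, this]; ring
  refine ⟨S, p, barrier' h (by linarith) fun s hs hsp => ?_⟩
  have := hS s hs δ (φ s)
  rw [hsp] at *
  rw [abs_lt, hFp] at this
  linarith [this.2]

lemma exists_lower_zero {φ : ℝ → ℝ} (h : Sol 0 φ) (h0 : φ 0 = 3 * Real.pi / 2) :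
    ∃ S A : ℝ, ∀ s ≤ S, A ≤ φ s := by
  have hG : ∀ s ≤ 0, G φ s = 0 := by
    intro s hs
    have hcont : ContinuousOn (fun s => |W s| + |Z s|) (Set.Icc (-(-s)) 0) := fun t _ =>
      ((hasDerivAt_W t).continuousAt.abs.add (hasDerivAt_Z t).continuousAt.abs).continuousWithinAt
    obtain ⟨M, hM⟩ := isCompact_Icc.bddAbove_image hcont
    have := G_bound le_rfl h (by simpa using h0) (T := -s) (M := M) (by linarith)
      (fun t ht => hM ⟨t, ht, rfl⟩) s ⟨by linarith, hs⟩
    rw [zero_mul] at this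
    exact abs_nonpos_iff.1 this
  obtain ⟨n, hn⟩ := exists_nat_gt (-φ (-22.5) / Real.pi)
  rw [div_lt_iff₀ Real.pi_pos] at hn
  refine ⟨-22.5, -(n * Real.pi), fun s hs => ?_⟩
  by_contra hc
  push Not at hc
  have hcont : ContinuousOn φ (Set.Icc s (-22.5)) := fun t _ => (h t).continuousAt.continuousWithinAt
  obtain ⟨t, ht, htt⟩ := intermediate_value_Icc hs hcont
    (show -(n * Real.pi) ∈ Set.Icc (φ s) (φ (-22.5)) from ⟨hc.le, by linarith⟩)
  have hz := Z_pos ht.2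
  have hg := hG t (ht.2.trans (by norm_num))
  rw [G, htt, Real.sin_neg, Real.sin_nat_mul_pi, Real.cos_neg, Real.cos_nat_mul_pi] at hg
  rcases neg_one_pow_eq_or ℝ n with h1 | h1 <;> rw [h1] at hg <;> linarith

end Angle
namespace Angle

lemma growth {δ : ℝ} {φ : ℝ → ℝ} (hδ : δ ≤ 0.0004) (h : Sol δ φ) {x y : ℝ}
    (hx : -22.5 ≤ x) (hxy : x ≤ y) (hy : y ≤ 0) : 0.0005 * (y - x) ≤ φ y - φ x := by
  refine Convex.mul_sub_le_image_sub_of_le_deriv (convex_Icc (-22.5 : ℝ) 0)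
    (fun t _ => (h t).continuousAt.continuousWithinAt)
    (fun t _ => (h t).differentiableAt.differentiableWithinAt) ?_ x ⟨hx, hxy.trans hy⟩ y
    ⟨hx.trans hxy, hy⟩ hxy
  intro t ht
  rw [interior_Icc] at ht
  rw [(h t).deriv]
  have hu1 : -0.995 < U t := U_b.1.trans_le (U_strictMono.monotone ht.1.le)
  have hu2 : U t ≤ 0 := by rw [← U_zero]; exact U_strictMono.monotone ht.2.le
  have hsc := Real.sin_sq_add_cos_sq (φ t)
  generalize Real.sin (φ t) = a at *
  generalize Real.cos (φ t) = b at *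
  have i1 : 0 ≤ (1 + U t - 0.005) * (b + 4 / 9 * a) ^ 2 := by
    apply mul_nonneg _ (sq_nonneg _)
    norm_num at *; linarith
  have i2 : 0 ≤ (1 - U t - 0.005) * (b - 4 / 9 * a) ^ 2 := by
    apply mul_nonneg _ (sq_nonneg _)
    norm_num at *; linarith
  have i3 : 0 ≤ a ^ 2 := sq_nonneg a
  have i4 : 0 ≤ b ^ 2 := sq_nonneg b
  norm_num at *
  nlinarith

lemma sin_ge {η x : ℝ} (h0 : 0 ≤ η) (h1 : η ≤ x) (h2 : x ≤ Real.pi - η) :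
    Real.sin η ≤ Real.sin x := by
  rcases le_total x (Real.pi / 2) with h | h
  · exact Real.sin_le_sin_of_le_of_le_pi_div_two (by linarith [Real.pi_pos]) h h1
  · rw [← Real.sin_pi_sub x]
    exact Real.sin_le_sin_of_le_of_le_pi_div_two (by linarith [Real.pi_pos]) (by linarith)
      (by linarith)

lemma exists_delta : ∃ δ0 : ℝ, 0 < δ0 ∧ δ0 ≤ 0.0004 ∧ ∀ δ : ℝ, 0 ≤ δ → δ < δ0 → ∀ φ : ℝ → ℝ,
    Sol δ φ → φ 0 = 3 * Real.pi / 2 + δ → φ (-22.5) ≤ 0 := by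
  have hZc : ∀ s : Set ℝ, ContinuousOn Z s := fun s t _ =>
    (hasDerivAt_Z t).continuousAt.continuousWithinAt
  obtain ⟨sa, hsa, hza⟩ := intermediate_value_Icc (by norm_num : (-9:ℝ) ≤ 0) (hZc _)
    (show (0:ℝ) ∈ Set.Icc (Z (-9)) (Z 0) from ⟨Z_a.le, by rw [Z_zero]; norm_num⟩)
  obtain ⟨sb, hsb, hzb⟩ := intermediate_value_Icc' (by norm_num : (-22.5:ℝ) ≤ -9) (hZc _)
    (show (0:ℝ) ∈ Set.Icc (Z (-9)) (Z (-22.5)) from ⟨Z_a.le, (Z_pos le_rfl).le⟩)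
  have hba : sb < sa := by
    rcases lt_or_eq_of_le hsb.2 with h | h
    · linarith [hsa.1]
    · rw [h] at hzb; exact absurd hzb Z_a.ne
  have h1b : -22.5 < sb := by
    rcases lt_or_eq_of_le hsb.1 with h | h
    · exact h
    · rw [← h] at hzb; exact absurd hzb (Z_pos le_rfl).ne'
  have hwa := abs_pos.2 (W_ne hza)
  have hwb := abs_pos.2 (W_ne hzb)
  have hcont : ContinuousOn (fun s => |W s| + |Z s|) (Set.Icc (-22.5) 0) := fun t _ =>
    ((hasDerivAt_W t).continuousAt.abs.add (hasDerivAt_Z t).continuousAt.abs).continuousWithinAt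
  obtain ⟨M, hM⟩ := isCompact_Icc.bddAbove_image hcont
  have hM0 : 0 ≤ M := le_trans (by positivity)
    (hM ⟨0, ⟨by norm_num, le_rfl⟩, rfl⟩ : |W 0| + |Z 0| ≤ M)
  set C := Real.exp (2 * 22.5) + M / 2 * Real.exp (2 * 22.5) with hC
  have hCpos : 0 < C := by positivity
  set η := 0.00025 * min (sa - sb) (sb - (-22.5)) with hη
  have hη1 : η ≤ 0.00025 * (sa - sb) := by
    rw [hη]; exact mul_le_mul_of_nonneg_left (min_le_left _ _) (by norm_num)
  have hη2 : η ≤ 0.00025 * (sb - (-22.5)) := by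
    rw [hη]; exact mul_le_mul_of_nonneg_left (min_le_right _ _) (by norm_num)
  have hηpos : 0 < η := mul_pos (by norm_num) (lt_min (by linarith) (by linarith))
  have hηs : η < 0.1 := by
    have := hsa.2; have := hsb.2; norm_num at *; linarith
  have hpi := Real.pi_gt_three
  have hsin : 0 < Real.sin η := Real.sin_pos_of_pos_of_lt_pi hηpos (by norm_num at *; linarith)
  set w := min |W sa| |W sb| with hw
  have hwpos : 0 < w := lt_min hwa hwb
  refine ⟨min 0.0004 (Real.sin η * w / C), lt_min (by norm_num) (by positivity),
    min_le_left _ _, ?_⟩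
  intro δ hδ0 hδ φ hφ h0
  have hδ1 : δ ≤ 0.0004 := hδ.le.trans (min_le_left _ _)
  have hδ2 : δ * C < Real.sin η * w := by
    rw [← lt_div_iff₀ hCpos]; exact hδ.trans_le (min_le_right _ _)
  have hG := G_bound hδ0 hφ h0 (T := 22.5) (M := M) (by norm_num)
    (fun t ht => hM ⟨t, ht, rfl⟩)
  rw [← hC] at hG
  have key : ∀ t ∈ Set.Icc (-22.5 : ℝ) 0, Z t = 0 → w ≤ |W t| → |Real.sin (φ t)| < Real.sin η := by
    intro t ht hz hwt
    have h1 := hG t ht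
    rw [G, hz, zero_mul, sub_zero, abs_mul] at h1
    by_contra hc
    push Not at hc
    have h2 : w * Real.sin η ≤ |W t| * |Real.sin (φ t)| :=
      mul_le_mul hwt hc hsin.le (abs_nonneg _)
    linarith
  have ka := key sa ⟨by linarith, hsa.2⟩ hza (min_le_left _ _)
  have kb := key sb ⟨hsb.1, by linarith [hsa.2]⟩ hzb (min_le_right _ _)
  have g1 := growth hδ1 hφ (x := sa) (y := 0) (by linarith) hsa.2 le_rfl
  have g2 := growth hδ1 hφ (x := sb) (y := sa) (by linarith) hba.le hsa.2
  have g3 := growth hδ1 hφ (x := -22.5) (y := sb) le_rfl h1b.le (by linarith [hsa.2])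
  rw [abs_lt] at ka kb
  have c1 : φ sa ≤ Real.pi + η := by
    by_contra hc
    push Not at hc
    have hx : φ sa - Real.pi ≤ Real.pi - η := by
      have := hsa.2
      norm_num at *
      linarith
    have := sin_ge hηpos.le (by linarith : η ≤ φ sa - Real.pi) hx
    rw [Real.sin_sub_pi] at this
    linarith [ka.1]
  have c2 : φ sb ≤ η := by
    by_contra hc
    push Not at hc
    have hx : φ sb ≤ Real.pi - η := by
      norm_num at *
      linarith
    have := sin_ge hηpos.le hc.le hx
    linarith [kb.2]
  norm_num at *
  linarith

end Angle

theorem stmt18 :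
    ∃ ε : ℝ, 0 < ε ∧ ∃ δ0 : ℝ, 0 < δ0 ∧
      ∀ δ : ℝ, 0 ≤ δ → δ < δ0 →
        ∀ φ : ℝ → ℝ,
          (∀ s : ℝ, HasDerivAt φ
            (Real.cos (φ s) ^ 2 + (16 / 81) * Real.sin (φ s) ^ 2
              - (8 / 9) * (-Real.tanh (s / 9)) * Real.sin (φ s) * Real.cos (φ s) - δ) s) →
          φ 0 = 3 * Real.pi / 2 + δ →
          (∀ s : ℝ, 0.995 < -Real.tanh (s / 9) → φ s < Real.arctan (9 / 4) - ε) ∧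
          (∃ L : ℝ, Filter.Tendsto φ Filter.atBot (nhds L) ∧
            L < Real.arctan (9 / 4) - ε) := by
  obtain ⟨δ0, hδ0, hδ04, H⟩ := Angle.exists_delta
  refine ⟨1 / 2, by norm_num, δ0, hδ0, ?_⟩
  intro δ hδ hδlt φ hφ' h0
  have hφ : Angle.Sol δ φ := hφ'
  have h1 := H δ hδ hδlt φ hφ h0
  have hneg : ∀ s ≤ -22.5, φ s ≤ 0 := Angle.barrier hφ h1 (fun s _ hs => by
    rw [hs]
    simp only [Real.cos_zero, Real.sin_zero]
    norm_num at *
    linarith)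
  have harc : 0 < Real.arctan (9 / 4) - 1 / 2 := by
    have h2 : Real.arctan 1 < Real.arctan (9 / 4) := Real.arctan_strictMono (by norm_num)
    rw [Real.arctan_one] at h2
    linarith [Real.pi_gt_three]
  refine ⟨fun s hs => ?_, ?_⟩
  · refine (hneg s ?_).trans_lt harc
    by_contra hc
    push Not at hc
    have h2 : Angle.U (-22.5) < Angle.U s := Angle.U_strictMono hc
    have h3 := Angle.U_b.1
    have h4 : Angle.U s = Real.tanh (s / 9) := rfl
    linarith
  · obtain ⟨S, A, hA⟩ : ∃ S A : ℝ, ∀ s ≤ S, A ≤ φ s := by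
      rcases hδ.eq_or_lt with h | h
      · subst h
        exact Angle.exists_lower_zero hφ (by simpa using h0)
      · exact Angle.exists_lower_pos h hφ
    obtain ⟨L, hL⟩ := Angle.exists_limit hφ (S := min S (-22.5)) (A := A) (B := 0)
      (fun s hs => hA s (hs.trans (min_le_left _ _)))
      (fun s hs => hneg s (hs.trans (min_le_right _ _)))
    refine ⟨L, hL, lt_of_le_of_lt ?_ harc⟩
    exact le_of_tendsto hL (Filter.eventually_atBot.2 ⟨-22.5, hneg⟩)
end

section
/- Let ε ∈ (0, arctan(9/4)) and let δ satisfy 0 ≤ δ < (97/81)·sin²(ε). Set B = arctan(9/4) − ε. Then for every h ∈ [−1, 1], the right-hand side of the δ-adjusted angle ODE evaluated at φ = B is positive: (cos(B) − (4/9)·h·sin(B))² + (16/81)·(1 − h²)·sin²(B) − δ ≥ (97/81)·sin²(ε) − δ > 0. Consequently, if φ : ℝ → ℝ is any solution of the δ-adjusted angle ODE and φ(s1) ≤ B at some s1 ∈ ℝ, then φ(s) ≤ B for all s ≤ s1. -/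
/-- For `ε ∈ (0, arctan(9/4))` and `0 ≤ δ < (97/81)·sin²ε`, the
right-hand side of the δ-adjusted angle ODE at `φ = B := arctan(9/4) − ε` is
bounded below by `(97/81)·sin²ε − δ > 0` for every `h ∈ [−1, 1]`; consequently
the region `{φ ≤ B}` is backward invariant for the δ-adjusted angle ODE. -/
theorem stmt19 (ε : ℝ) (hε0 : 0 < ε) (hε1 : ε < Real.arctan (9 / 4))
    (δ : ℝ) (hδ0 : 0 ≤ δ) (hδ1 : δ < (97 / 81) * Real.sin ε ^ 2)
    (B : ℝ) (hB : B = Real.arctan (9 / 4) - ε) :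
    ((97 / 81) * Real.sin ε ^ 2 - δ > 0) ∧
    (∀ h : ℝ, h ∈ Set.Icc (-1 : ℝ) 1 →
      (Real.cos B - (4 / 9) * h * Real.sin B) ^ 2
        + (16 / 81) * (1 - h ^ 2) * Real.sin B ^ 2 - δ
        ≥ (97 / 81) * Real.sin ε ^ 2 - δ) ∧
    (∀ φ : ℝ → ℝ,
      (∀ s : ℝ, HasDerivAt φ
        (Real.cos (φ s) ^ 2 + (16 / 81) * Real.sin (φ s) ^ 2
          - (8 / 9) * (-Real.tanh (s / 9)) * Real.sin (φ s) * Real.cos (φ s) - δ) s) →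
      ∀ s1 : ℝ, φ s1 ≤ B → ∀ s : ℝ, s ≤ s1 → φ s ≤ B) := by
  have hA : Real.arctan (9 / 4) < Real.pi / 2 := Real.arctan_lt_pi_div_two _
  have hs : 0 ≤ Real.sin B := Real.sin_nonneg_of_nonneg_of_le_pi (by linarith) (by linarith [Real.pi_pos])
  have hc : 0 ≤ Real.cos B := Real.cos_nonneg_of_neg_pi_div_two_le_of_le
    (by linarith [Real.pi_pos]) (by linarith)
  have hcA : Real.cos (Real.arctan (9 / 4)) ^ 2 = 16 / 97 := by
    rw [Real.cos_sq_arctan]; norm_num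
  have hcpos : Real.cos (Real.arctan (9 / 4)) ≠ 0 := (Real.cos_arctan_pos _).ne'
  have hsA : Real.sin (Real.arctan (9 / 4)) = 9 / 4 * Real.cos (Real.arctan (9 / 4)) := by
    have := Real.tan_arctan (9 / 4)
    rw [Real.tan_eq_sin_div_cos, div_eq_iff hcpos] at this
    exact this
  have hkey : (97 / 81) * Real.sin ε ^ 2 = (Real.cos B - 4 / 9 * Real.sin B) ^ 2 := by
    have he : ε = Real.arctan (9 / 4) - B := by linarith
    rw [he, Real.sin_sub, hsA]
    linear_combination (97 / 81) * (9 / 4 * Real.cos B - Real.sin B) ^ 2 * hcA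
  have hbound : ∀ h : ℝ, h ∈ Set.Icc (-1 : ℝ) 1 →
      (Real.cos B - (4 / 9) * h * Real.sin B) ^ 2
        + (16 / 81) * (1 - h ^ 2) * Real.sin B ^ 2 - δ
        ≥ (97 / 81) * Real.sin ε ^ 2 - δ := by
    intro h hh
    rw [hkey]
    have := mul_nonneg (mul_nonneg hs hc) (sub_nonneg.2 hh.2)
    nlinarith
  refine ⟨by linarith, hbound, ?_⟩
  intro φ hφ s1 h1 s hs1
  have hd : ∀ t : ℝ, HasDerivAt (fun t => φ (-t)) _ t := fun t =>
    (hφ (-t)).scomp t (hasDerivAt_neg t)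
  have := image_le_of_deriv_right_lt_deriv_boundary (f := fun t => φ (-t)) (a := -s1) (b := -s)
    (B := fun _ => B) (B' := fun _ => 0)
    (fun t _ => (hd t).continuousAt.continuousWithinAt)
    (fun t _ => (hd t).hasDerivWithinAt) (by simpa using h1)
    (fun t => hasDerivAt_const t B) ?_ (x := -s) ⟨by linarith, le_rfl⟩
  · simpa using this
  · intro t _ ht
    have ht' : φ (-t) = B := ht
    have hb := hbound (-Real.tanh (-t / 9))
      ⟨by linarith [Real.tanh_lt_one (-t / 9)], by linarith [Real.neg_one_lt_tanh (-t / 9)]⟩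
    simp only [ht', smul_eq_mul]
    nlinarith
end
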